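/- For every rational β > 0 there exists an oracle Turing machine f such that for every infinite binary sequence x with 0 < dim(x) < β, the machine f with oracle x computes a total infinite binary sequence f(x) with Dim(f(x)) ≥ 1 − ε, where ε = β/dim(x) − 1. -/

import Mathlib

/-- Binary strings. -/
abbrev Str := List Bool

/-- `U` is an optimal universal conditional machine: it is partial computable and,
for every partial computable `M`, programs for `M` can be translated to programs
for `U` with only a constant-length overhead. -/
def UniversalM (U : Str × Str →. Str) : Prop :=
  Partrec U ∧
    ∀ M : Str × Str →. Str, Partrec M →
      ∃ c : ℕ, ∀ x y p : Str, x ∈ M (p, y) →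
        ∃ q : Str, x ∈ U (q, y) ∧ q.length ≤ p.length + c

/-- Conditional plain Kolmogorov complexity `C(x|y)` with respect to `U`. -/
noncomputable def KC (U : Str × Str →. Str) (x y : Str) : ℕ :=
  sInf {l : ℕ | ∃ p : Str, p.length = l ∧ x ∈ U (p, y)}

/-- Unconditional plain complexity `C(x) = C(x|λ)`. -/
noncomputable def KC0 (U : Str × Str →. Str) (x : Str) : ℕ := KC U x []

/-- Complexity conditioned on (the binary representation of) a natural number. -/
noncomputable def KCn (U : Str × Str →. Str) (x : Str) (n : ℕ) : ℕ := KC U x (Nat.bits n)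

/-- The length-`n` prefix of an infinite binary sequence. -/
def pre (x : ℕ → Bool) (n : ℕ) : Str := List.ofFn (fun i : Fin n => x i)

/-- `Φ` is (the finite-use functional of) an oracle Turing machine that, with oracle
`A`, totally computes the sequence `B`: answers obtained from finite prefixes of `A`
are consistent, and every bit of `B` is obtained from some finite prefix of `A`. -/
def TuringComputes (Φ : Str → ℕ →. Bool) (A B : ℕ → Bool) : Prop :=
  (∀ (n m₁ m₂ : ℕ) (b₁ b₂ : Bool),
      b₁ ∈ Φ (pre A m₁) n → b₂ ∈ Φ (pre A m₂) n → b₁ = b₂) ∧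
  (∀ n, ∃ m, B n ∈ Φ (pre A m) n)

/-- `B` is Turing-reducible to `A`. -/
def TuringLE (B A : ℕ → Bool) : Prop :=
  ∃ Φ : Str → ℕ →. Bool, Partrec₂ Φ ∧ TuringComputes Φ A B

/-- The effective Hausdorff dimension of a sequence: `liminf C(x↾n)/n`. -/
noncomputable def dimOf (U : Str × Str →. Str) (x : ℕ → Bool) : ℝ :=
  Filter.liminf (fun n : ℕ => (KC0 U (pre x n) : ℝ) / (n : ℝ)) Filter.atTop

/-- The effective packing dimension of a sequence: `limsup C(x↾n)/n`. -/
noncomputable def DimOf (U : Str × Str →. Str) (x : ℕ → Bool) : ℝ :=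
  Filter.limsup (fun n : ℕ => (KC0 U (pre x n) : ℝ) / (n : ℝ)) Filter.atTop

theorem Partrec.exists_primrec_enumeration {α γ : Type*} [Primcodable α] [Primcodable γ]
    {f : α →. γ} (hf : Partrec f) :
    ∃ E : ℕ → Option (α × γ), Primrec E ∧
      (∀ k a b, E k = some (a, b) → b ∈ f a) ∧
      ∀ a b, b ∈ f a → ∀ K, ∃ k, K ≤ k ∧ E k = some (a, b) := by
  obtain ⟨c, hc⟩ := Nat.Partrec.Code.exists_code.1 hf
  have hev : ∀ a : α, c.eval (Encodable.encode a) = (f a).map Encodable.encode := by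
    intro a
    rw [hc]
    simp
  refine ⟨fun k => (Encodable.decode (α := α) k.unpair.1).bind fun a =>
    ((c.evaln k.unpair.2 (Encodable.encode a)).bind
      (Encodable.decode (α := γ))).map fun b => (a, b), ?_, ?_, ?_⟩
  · refine Primrec.option_bind (Primrec.decode.comp (Primrec.fst.comp Primrec.unpair)) ?_
    refine Primrec.option_map (f := fun q : ℕ × α =>
      (c.evaln q.1.unpair.2 (Encodable.encode q.2)).bind (Encodable.decode (α := γ)))
      (g := fun (q : ℕ × α) (b : γ) => (q.2, b)) ?_ ?_
    · refine Primrec.option_bind ?_ (Primrec.decode.comp Primrec.snd)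
      exact Nat.Partrec.Code.primrec_evaln.comp
        (((Primrec.snd.comp (Primrec.unpair.comp Primrec.fst)).pair (Primrec.const c)).pair
          (Primrec.encode.comp Primrec.snd))
    · exact (Primrec.snd.comp Primrec.fst).pair Primrec.snd
  · intro k a b h
    simp only [Option.bind_eq_some_iff, Option.map_eq_some_iff] at h
    obtain ⟨a', -, b', ⟨n, hn, hb⟩, he⟩ := h
    obtain ⟨rfl, rfl⟩ := Prod.mk.inj he
    have h2 := Nat.Partrec.Code.evaln_sound (Option.mem_def.2 hn)
    rw [hev] at h2
    obtain ⟨b'', hb'', rfl⟩ := (Part.mem_map_iff _).1 h2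
    rw [Encodable.encodek] at hb
    cases hb
    exact hb''
  · intro a b h K
    have h1 : Encodable.encode b ∈ c.eval (Encodable.encode a) := by
      rw [hev]
      exact Part.mem_map _ h
    obtain ⟨t, ht⟩ := Nat.Partrec.Code.evaln_complete.1 h1
    refine ⟨Nat.pair (Encodable.encode a) (max t K),
      (le_max_right t K).trans (Nat.right_le_pair _ _), ?_⟩
    have h2 := Option.mem_def.1 (Nat.Partrec.Code.evaln_mono (le_max_left t K) ht)
    simp [h2]

section Complexity

variable {U : Str × Str →. Str}

theorem KC0_le_of_mem {s p : Str} (h : s ∈ U (p, [])) : KC0 U s ≤ p.length :=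
  Nat.sInf_le ⟨p, rfl, h⟩

theorem UniversalM.exists_KC0_le_length (hU : UniversalM U) :
    ∃ c : ℕ, ∀ s : Str, KC0 U s ≤ s.length + c := by
  obtain ⟨c, hc⟩ := hU.2 (fun q => Part.some q.1) Computable.fst
  refine ⟨c, fun s => ?_⟩
  obtain ⟨q, hq, hl⟩ := hc s [] s (Part.mem_some s)
  exact (KC0_le_of_mem hq).trans hl

theorem UniversalM.exists_program (hU : UniversalM U) (s : Str) :
    ∃ p : Str, p.length = KC0 U s ∧ s ∈ U (p, []) := by
  obtain ⟨c, hc⟩ := hU.2 (fun q => Part.some q.1) Computable.fst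
  obtain ⟨q, hq, -⟩ := hc s [] s (Part.mem_some s)
  exact Nat.sInf_mem (s := {l : ℕ | ∃ p : Str, p.length = l ∧ s ∈ U (p, [])})
    ⟨q.length, q, rfl, hq⟩

/-- A string is recovered from a program for it that has been prefixed by `w`, at the cost of
encoding the length of `w` in unary. -/
theorem UniversalM.exists_KC0_le_append (hU : UniversalM U) :
    ∃ c : ℕ, ∀ w p s : Str, s ∈ U (p, []) → KC0 U s ≤ KC0 U (w ++ p) + w.length + c := by
  have hM : Partrec fun q : Str × Str =>
      (U ((q.1.dropWhile id).tail, [])).bind fun v =>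
        U (v.drop (q.1.takeWhile id).length, []) := by
    refine Partrec.bind (hU.1.comp ?_) (hU.1.comp (f := U)
      (g := fun r : (Str × Str) × Str =>
        (r.2.drop (r.1.1.takeWhile id).length, ([] : Str))) ?_)
    · exact ((Primrec.list_tail.comp
        ((Primrec.list_dropWhile Primrec.id).comp Primrec.fst)).pair (Primrec.const [])).to_comp
    · exact ((Primrec.list_drop.comp
        (Primrec.list_length.comp ((Primrec.list_takeWhile Primrec.id).comp
          (Primrec.fst.comp Primrec.fst))) Primrec.snd).pair (Primrec.const [])).to_comp
  obtain ⟨c, hc⟩ := hU.2 _ hM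
  refine ⟨c + 1, fun w p s h => ?_⟩
  obtain ⟨r, hr, hr'⟩ := hU.exists_program (w ++ p)
  obtain ⟨q, hq, hl⟩ := hc s [] (List.replicate w.length true ++ false :: r) (by
    have h1 : (List.replicate w.length true ++ false :: r).takeWhile id
        = List.replicate w.length true := by
      rw [List.takeWhile_append_of_pos (by simp)]
      simp
    have h2 : (List.replicate w.length true ++ false :: r).dropWhile id = false :: r := by
      rw [List.dropWhile_append_of_pos (by simp)]
      simp
    simp only [h1, h2]
    exact Part.mem_bind hr' (by simpa using h))
  have := KC0_le_of_mem hq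
  simp at hl
  omega

end Complexity

section Prefix

variable (x : ℕ → Bool)

@[simp] theorem length_pre (n : ℕ) : (pre x n).length = n := by simp [pre]

theorem take_pre {n m : ℕ} (h : n ≤ m) : (pre x m).take n = pre x n := by
  apply List.ext_getElem
  · simpa using h
  · intro i h1 h2
    simp [pre]

end Prefix

/-- The block appended at stage `k` to the output `w`, when `E` enumerates pairs of a program and
its output: the `k`-th enumerated program, if it is long compared to `w` and compresses a prefix
of the oracle below the ratio `a / b`. -/
def nextBlock (E : ℕ → Option (Str × Str)) (a b : ℕ) (σ : Str) (k : ℕ) (w : Str) : Str :=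
  ((E k).map fun q =>
    if w.length * w.length < q.1.length ∧ q.1.length * b < a * q.2.length ∧
      q.2.length ≤ k ∧ σ.take q.2.length = q.2 then q.1 else []).getD []

/-- The concatenation of the blocks appended before stage `k`. -/
def blocks (E : ℕ → Option (Str × Str)) (a b : ℕ) (σ : Str) (k : ℕ) : Str :=
  Nat.rec [] (fun j w => w ++ nextBlock E a b σ j w) k

section Blocks

variable {E : ℕ → Option (Str × Str)} {a b : ℕ}

theorem primrec_blocks (hE : Primrec E) :
    Primrec fun σ : Str => blocks E a b σ σ.length := by
  refine Primrec.nat_rec' Primrec.list_length (Primrec.const [])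
    (h := fun (σ : Str) (q : ℕ × Str) => q.2 ++ nextBlock E a b σ q.1 q.2) ?_
  refine Primrec.list_append.comp (Primrec.snd.comp Primrec.snd) ?_
  refine Primrec.option_getD.comp (Primrec.option_map
    (hE.comp (Primrec.fst.comp Primrec.snd)) ?_) (Primrec.const [])
  have hw : Primrec fun r : (Str × ℕ × Str) × (Str × Str) => r.1.2.2.length :=
    Primrec.list_length.comp (Primrec.snd.comp (Primrec.snd.comp Primrec.fst))
  have hk : Primrec fun r : (Str × ℕ × Str) × (Str × Str) => r.1.2.1 :=
    Primrec.fst.comp (Primrec.snd.comp Primrec.fst)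
  have hp : Primrec fun r : (Str × ℕ × Str) × (Str × Str) => r.2.1 :=
    Primrec.fst.comp Primrec.snd
  have hs : Primrec fun r : (Str × ℕ × Str) × (Str × Str) => r.2.2 :=
    Primrec.snd.comp Primrec.snd
  have hpl := Primrec.list_length.comp hp
  have hsl := Primrec.list_length.comp hs
  refine Primrec.ite ?_ hp (Primrec.const [])
  refine (Primrec.nat_lt.comp (Primrec.nat_mul.comp hw hw) hpl).and
    ((Primrec.nat_lt.comp (Primrec.nat_mul.comp hpl (Primrec.const b))
      (Primrec.nat_mul.comp (Primrec.const a) hsl)).and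
    ((Primrec.nat_le.comp hsl hk).and (Primrec.eq.comp ?_ hs)))
  exact Primrec.list_take.comp hsl (Primrec.fst.comp Primrec.fst)

theorem blocks_succ (σ : Str) (k : ℕ) :
    blocks E a b σ (k + 1) = blocks E a b σ k ++ nextBlock E a b σ k (blocks E a b σ k) := rfl

theorem nextBlock_pre_congr (x : ℕ → Bool) {k m m' : ℕ} (h : k ≤ m) (h' : k ≤ m') (w : Str) :
    nextBlock E a b (pre x m) k w = nextBlock E a b (pre x m') k w := by
  unfold nextBlock
  congr 2
  funext q
  by_cases hq : q.2.length ≤ k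
  · rw [take_pre x (hq.trans h), take_pre x (hq.trans h')]
  · simp [hq]

theorem blocks_pre_congr (x : ℕ → Bool) {k m m' : ℕ} (h : k ≤ m) (h' : k ≤ m') :
    blocks E a b (pre x m) k = blocks E a b (pre x m') k := by
  induction k with
  | zero => rfl
  | succ k ih =>
    rw [blocks_succ, blocks_succ, ih (by omega) (by omega),
      nextBlock_pre_congr x (m := m) (m' := m') (by omega) (by omega)]

theorem blocks_pre_succ (x : ℕ → Bool) (k : ℕ) :
    blocks E a b (pre x (k + 1)) (k + 1) =
      blocks E a b (pre x k) k ++ nextBlock E a b (pre x k) k (blocks E a b (pre x k) k) := by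
  rw [blocks_succ, blocks_pre_congr x (m' := k) (Nat.le_succ k) le_rfl,
    nextBlock_pre_congr x (m' := k) (Nat.le_succ k) le_rfl]

theorem blocks_pre_prefix (x : ℕ → Bool) {k l : ℕ} (h : k ≤ l) :
    blocks E a b (pre x k) k <+: blocks E a b (pre x l) l := by
  induction l, h using Nat.le_induction with
  | base => exact List.prefix_rfl
  | succ l _ ih =>
    rw [blocks_pre_succ]
    exact ih.trans (List.prefix_append _ _)

theorem nextBlock_pre_of_ne_nil {x : ℕ → Bool} {k : ℕ} {w : Str}
    (h : nextBlock E a b (pre x k) k w ≠ []) :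
    ∃ p n, E k = some (p, pre x n) ∧ w.length * w.length < p.length ∧
      p.length * b < a * n ∧ nextBlock E a b (pre x k) k w = p := by
  unfold nextBlock at h ⊢
  cases hq : E k with
  | none => simp [hq] at h
  | some q =>
    obtain ⟨p, s⟩ := q
    simp only [hq, Option.map_some, Option.getD_some] at h ⊢
    split_ifs at h ⊢ with hc
    · obtain ⟨h1, h2, h3, h4⟩ := hc
      rw [take_pre x h3] at h4
      exact ⟨p, s.length, by rw [h4], h1, h2, rfl⟩
    · exact absurd rfl h

theorem nextBlock_pre_eq {x : ℕ → Bool} {k n : ℕ} {w p : Str} (hE : E k = some (p, pre x n))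
    (hn : n ≤ k) (hw : w.length * w.length < p.length) (hp : p.length * b < a * n) :
    nextBlock E a b (pre x k) k w = p := by
  simp [nextBlock, hE, hw, hp, hn, take_pre x hn]

end Blocks

/-- The functional that outputs the bits of the blocks built from the known oracle prefix. -/
def blockFunctional (E : ℕ → Option (Str × Str)) (a b : ℕ) (σ : Str) : ℕ →. Bool :=
  fun n => ((blocks E a b σ σ.length)[n]? : Option Bool)

theorem partrec_blockFunctional {E : ℕ → Option (Str × Str)} (hE : Primrec E) (a b : ℕ) :
    Partrec₂ (blockFunctional E a b) :=
  Computable.ofOption (Primrec.list_getElem?.comp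
    ((primrec_blocks hE).comp Primrec.fst) Primrec.snd).to_comp

theorem exists_turingComputes_blockFunctional {E : ℕ → Option (Str × Str)} {a b : ℕ}
    {x : ℕ → Bool} (hx : ∀ N, ∃ k, N < (blocks E a b (pre x k) k).length) :
    ∃ B : ℕ → Bool, TuringComputes (blockFunctional E a b) x B ∧
      ∀ k, pre B (blocks E a b (pre x k) k).length = blocks E a b (pre x k) k := by
  choose K hK using hx
  have key : ∀ k n c, (blocks E a b (pre x k) k)[n]? = some c →
      c = (blocks E a b (pre x (K n)) (K n))[n]'(hK n) := by
    intro k n c h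
    obtain ⟨hn, rfl⟩ := List.getElem?_eq_some_iff.1 h
    rcases le_total k (K n) with hk | hk
    · exact (blocks_pre_prefix x hk).getElem hn
    · exact ((blocks_pre_prefix x hk).getElem (hK n)).symm
  have mem : ∀ n m c, c ∈ blockFunctional E a b (pre x m) n ↔
      (blocks E a b (pre x m) m)[n]? = some c := by
    intro n m c
    simp [blockFunctional]
  refine ⟨fun n => (blocks E a b (pre x (K n)) (K n))[n]'(hK n), ⟨?_, ?_⟩, ?_⟩
  · intro n m₁ m₂ b₁ b₂ h₁ h₂
    rw [key _ _ _ ((mem _ _ _).1 h₁), key _ _ _ ((mem _ _ _).1 h₂)]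
  · exact fun n => ⟨K n, (mem _ _ _).2 (List.getElem?_eq_getElem (hK n))⟩
  · intro k
    apply List.ext_getElem
    · simp
    · intro n h1 h2
      rw [key k n _ (List.getElem?_eq_getElem h2)]
      simp [pre]

/-- Compressible prefixes of growing complexity make the output grow forever. -/
theorem exists_length_blocks_lt {U : Str × Str →. Str} (hU : UniversalM U)
    {E : ℕ → Option (Str × Str)} {a b : ℕ} {x : ℕ → Bool}
    (hE : ∀ p s, s ∈ U (p, []) → ∀ K, ∃ k, K ≤ k ∧ E k = some (p, s))
    (hx : ∀ N, ∃ n, N < KC0 U (pre x n) ∧ KC0 U (pre x n) * b < a * n) (N : ℕ) :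
    ∃ k, N < (blocks E a b (pre x k) k).length := by
  have step : ∀ k, ∃ l, (blocks E a b (pre x k) k).length <
      (blocks E a b (pre x l) l).length := by
    intro k
    by_contra! hcon
    set w := blocks E a b (pre x k) k with hw
    obtain ⟨n, hn, hn'⟩ := hx (w.length * w.length)
    obtain ⟨p, hp, hps⟩ := hU.exists_program (pre x n)
    obtain ⟨l, hl, hEl⟩ := hE p _ hps (max k n)
    have hkl : k ≤ l := (le_max_left _ _).trans hl
    have heq : blocks E a b (pre x l) l = w :=
      ((blocks_pre_prefix x hkl).eq_of_length_le (hcon l)).symm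
    have h1 := hcon (l + 1)
    rw [blocks_pre_succ, heq, nextBlock_pre_eq hEl ((le_max_right _ _).trans hl)
      (by omega) (by rw [hp]; exact hn'), List.length_append] at h1
    have : 0 < p.length := by omega
    omega
  induction N with
  | zero =>
    obtain ⟨l, hl⟩ := step 0
    exact ⟨l, by omega⟩
  | succ N ih =>
    obtain ⟨k, hk⟩ := ih
    obtain ⟨l, hl⟩ := step k
    exact ⟨l, by omega⟩

theorem exists_blocks_eq_append {E : ℕ → Option (Str × Str)} {a b : ℕ} {x : ℕ → Bool}
    (hx : ∀ N, ∃ k, N < (blocks E a b (pre x k) k).length) (N : ℕ) :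
    ∃ k p n, N < (blocks E a b (pre x k) k).length ∧ E k = some (p, pre x n) ∧
      (blocks E a b (pre x k) k).length * (blocks E a b (pre x k) k).length < p.length ∧
      p.length * b < a * n ∧
      blocks E a b (pre x (k + 1)) (k + 1) = blocks E a b (pre x k) k ++ p := by
  obtain ⟨k₀, hk₀⟩ := hx N
  have : ∃ k, k₀ ≤ k ∧
      nextBlock E a b (pre x k) k (blocks E a b (pre x k) k) ≠ [] := by
    by_contra! hcon
    have hst : ∀ l, k₀ ≤ l → blocks E a b (pre x l) l = blocks E a b (pre x k₀) k₀ := by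
      intro l hl
      induction l, hl using Nat.le_induction with
      | base => rfl
      | succ l hl ih => rw [blocks_pre_succ, hcon l hl, ih, List.append_nil]
    obtain ⟨l, hl⟩ := hx (blocks E a b (pre x k₀) k₀).length
    rcases le_total k₀ l with h | h
    · rw [hst l h] at hl
      exact lt_irrefl _ hl
    · exact absurd (blocks_pre_prefix x h).length_le (not_le.2 hl)
  obtain ⟨k, hk, hne⟩ := this
  obtain ⟨p, n, h1, h2, h3, h4⟩ := nextBlock_pre_of_ne_nil hne
  exact ⟨k, p, n, hk₀.trans_le (blocks_pre_prefix x hk).length_le, h1, h2, h3, by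
    rw [blocks_pre_succ, h4]⟩

section Dimension

variable {U : Str × Str →. Str}

theorem UniversalM.isBoundedUnder_le (hU : UniversalM U) (x : ℕ → Bool) :
    Filter.IsBoundedUnder (· ≤ ·) Filter.atTop
      (fun n : ℕ => (KC0 U (pre x n) : ℝ) / (n : ℝ)) := by
  obtain ⟨c, hc⟩ := hU.exists_KC0_le_length
  refine Filter.isBoundedUnder_of ⟨1 + c, fun n => ?_⟩
  rcases Nat.eq_zero_or_pos n with rfl | hn
  · simp
    positivity
  · have h1 : (1 : ℝ) ≤ n := by exact_mod_cast hn
    have h2 : (KC0 U (pre x n) : ℝ) ≤ n + c := by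
      have := hc (pre x n)
      rw [length_pre] at this
      exact_mod_cast this
    rw [div_le_iff₀ (by linarith)]
    nlinarith [Nat.cast_nonneg (α := ℝ) c]

theorem isBoundedUnder_ge_KC0_div (x : ℕ → Bool) :
    Filter.IsBoundedUnder (· ≥ ·) Filter.atTop
      (fun n : ℕ => (KC0 U (pre x n) : ℝ) / (n : ℝ)) :=
  Filter.isBoundedUnder_of ⟨0, fun _ => by positivity⟩

theorem eventually_mul_lt_KC0 {x : ℕ → Bool} {d : ℝ} (hd : d < dimOf U x) :
    ∀ᶠ n : ℕ in Filter.atTop, d * n < KC0 U (pre x n) := by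
  filter_upwards [Filter.eventually_lt_of_lt_liminf hd (isBoundedUnder_ge_KC0_div x),
    Filter.eventually_gt_atTop 0] with n h hn
  exact (lt_div_iff₀ (by exact_mod_cast hn)).1 h

theorem UniversalM.frequently_KC0_lt_mul (hU : UniversalM U) {x : ℕ → Bool} {d : ℝ}
    (hd : dimOf U x < d) :
    ∃ᶠ n : ℕ in Filter.atTop, (KC0 U (pre x n) : ℝ) < d * n := by
  have h := Filter.frequently_lt_of_liminf_lt (hU.isBoundedUnder_le x).isCoboundedUnder_ge hd
  refine (h.and_eventually (Filter.eventually_gt_atTop 0)).mono fun n hn => ?_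
  exact (div_lt_iff₀ (by exact_mod_cast hn.2)).1 hn.1

theorem UniversalM.exists_lt_KC0_lt_mul (hU : UniversalM U) {x : ℕ → Bool} {d : ℝ}
    (h0 : 0 < dimOf U x) (hd : dimOf U x < d) (N : ℕ) :
    ∃ n, N < KC0 U (pre x n) ∧ (KC0 U (pre x n) : ℝ) < d * n := by
  have h2 : (0 : ℝ) < dimOf U x / 2 := by linarith
  have hev := eventually_mul_lt_KC0 (U := U) (x := x) (half_lt_self h0)
  have hN : ∀ᶠ n : ℕ in Filter.atTop, (N : ℝ) < dimOf U x / 2 * n :=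
    (tendsto_natCast_atTop_atTop.const_mul_atTop h2).eventually_gt_atTop _
  obtain ⟨n, hn, h3, h4⟩ := ((hU.frequently_KC0_lt_mul hd).and_eventually (hev.and hN)).exists
  exact ⟨n, by exact_mod_cast h4.trans h3, hn⟩

end Dimension

/-- A sequence whose prefixes infinitely often end in a dominating block that is a program of
relative length at most `β` for a prefix of `x` has packing dimension at least `dim x / β`. -/
theorem UniversalM.dimOf_div_le_DimOf {U : Str × Str →. Str} (hU : UniversalM U) {β : ℝ}
    (hβ : 0 < β) {x B : ℕ → Bool}
    (h : ∀ N, ∃ w p : Str, ∃ n : ℕ, N < w.length ∧ w.length * w.length < p.length ∧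
      (p.length : ℝ) < β * n ∧ pre x n ∈ U (p, []) ∧
      pre B (w ++ p).length = w ++ p) :
    dimOf U x / β ≤ DimOf U B := by
  refine le_of_forall_lt fun r hr => ?_
  rcases lt_or_ge r 0 with hr0 | hr0
  · refine hr0.trans_le ?_
    exact Filter.le_limsup_of_frequently_le
      (Filter.Frequently.of_forall fun _ => by positivity) (hU.isBoundedUnder_le B)
  obtain ⟨t, hrt, ht⟩ := exists_between hr
  obtain ⟨s, hrs, hst⟩ := exists_between hrt
  refine hrs.trans_le ?_
  refine Filter.le_limsup_of_frequently_le ?_ (hU.isBoundedUnder_le B)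
  obtain ⟨c, hc⟩ := hU.exists_KC0_le_append
  rw [lt_div_iff₀ hβ] at ht
  obtain ⟨M, hM⟩ := Filter.eventually_atTop.1 (eventually_mul_lt_KC0 ht)
  have hts : 0 < t - s := by linarith
  obtain ⟨L, hL⟩ := exists_nat_gt ((s + 1 + c) / (t - s))
  obtain ⟨P, hP⟩ := exists_nat_gt (β * M)
  rw [Filter.frequently_atTop]
  intro m₀
  obtain ⟨w, p, n, hw, hwp, hpn, hU', hB⟩ := h (m₀ + L + P)
  refine ⟨(w ++ p).length, by simp; omega, ?_⟩
  rw [hB]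
  have hlen : w.length ≤ w.length * w.length := Nat.le_mul_self _
  have hpP : (P : ℝ) < p.length := by exact_mod_cast (by omega : P < p.length)
  have hn : M ≤ n := by
    have : β * M < β * n := by linarith
    exact_mod_cast (lt_of_mul_lt_mul_left this hβ.le).le
  have h1 := hM n hn
  have h2 : (KC0 U (pre x n) : ℝ) ≤ KC0 U (w ++ p) + w.length + c := by
    exact_mod_cast hc w p _ hU'
  have hLw : (L : ℝ) ≤ w.length := by exact_mod_cast (by omega : L ≤ w.length)
  have hw1 : (1 : ℝ) ≤ w.length := by exact_mod_cast (by omega : 1 ≤ w.length)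
  have hwp' : (w.length : ℝ) * w.length < p.length := by exact_mod_cast hwp
  have hp0 : (0 : ℝ) < p.length := by nlinarith
  rw [List.length_append, Nat.cast_add, le_div_iff₀ (by linarith)]
  have h3 : t * p.length ≤ t * β * n := by nlinarith
  rw [div_lt_iff₀ hts] at hL
  have h4 : s + 1 + c ≤ w.length * (t - s) := by nlinarith
  have h5 : w.length * (s + 1 + c) ≤ (w.length * w.length : ℝ) * (t - s) := by nlinarith
  have h6 : (w.length * w.length : ℝ) * (t - s) ≤ p.length * (t - s) := by nlinarith
  have h7 : (c : ℝ) ≤ w.length * c := le_mul_of_one_le_left (Nat.cast_nonneg c) hw1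
  nlinarith

/-- for every rational `β > 0` there is an oracle Turing machine that
from any sequence `x` with `0 < dim(x) < β` computes a sequence of effective packing
dimension at least `1 − ε`, where `ε = β/dim(x) − 1`. -/
theorem stmt18 (U : Str × Str →. Str) (hU : UniversalM U) (β : ℚ) (hβ : 0 < β) :
    ∃ Φ : Str → ℕ →. Bool, Partrec₂ Φ ∧
      ∀ x : ℕ → Bool, 0 < dimOf U x → dimOf U x < (β : ℝ) →
        ∃ B : ℕ → Bool, TuringComputes Φ x B ∧
          (1 : ℝ) - ((β : ℝ) / dimOf U x - 1) ≤ DimOf U B := by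
  obtain ⟨E, hEp, hEs, hEc⟩ := (hU.1.comp (Computable.id.pair (Computable.const [])) :
    Partrec fun p : Str => U (p, [])).exists_primrec_enumeration
  have hβ' : (0 : ℝ) < β := by exact_mod_cast hβ
  have hratio : ∀ l n : ℕ, l * β.den < β.num.toNat * n ↔ (l : ℝ) < β * n := by
    intro l n
    have hden : (0 : ℝ) < β.den := by exact_mod_cast β.den_pos
    have hnum : ((β.num.toNat : ℕ) : ℝ) = β * β.den := by
      have h1 : ((β.num.toNat : ℕ) : ℤ) = β.num := Int.toNat_of_nonneg (Rat.num_pos.2 hβ).le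
      have h2 : (β : ℚ) * β.den = β.num := Rat.mul_den_eq_num β
      have h3 : ((β.num.toNat : ℕ) : ℚ) = β * β.den := by
        rw [h2]
        exact_mod_cast congrArg (Int.cast : ℤ → ℚ) h1
      exact_mod_cast h3
    rw [← Nat.cast_lt (α := ℝ), Nat.cast_mul, Nat.cast_mul, hnum,
      show (β : ℝ) * β.den * n = β * n * β.den by ring, mul_lt_mul_iff_left₀ hden]
  refine ⟨blockFunctional E β.num.toNat β.den, partrec_blockFunctional hEp _ _, ?_⟩
  intro x h0 hd
  have hgrow := exists_length_blocks_lt (a := β.num.toNat) (b := β.den) (x := x) hU hEc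
    (fun N => by
      obtain ⟨n, h1, h2⟩ := hU.exists_lt_KC0_lt_mul h0 hd N
      exact ⟨n, h1, (hratio _ _).2 h2⟩)
  obtain ⟨B, hB, hpre⟩ := exists_turingComputes_blockFunctional hgrow
  refine ⟨B, hB, ?_⟩
  refine le_trans ?_ (hU.dimOf_div_le_DimOf hβ' (x := x) (B := B) fun N => ?_)
  · have h1 : (β : ℝ) / dimOf U x * (dimOf U x / β) = 1 := by field_simp
    have h2 : 0 < dimOf U x / (β : ℝ) := by positivity
    have h3 : 0 < (β : ℝ) / dimOf U x := by positivity
    nlinarith [sq_nonneg ((β : ℝ) / dimOf U x - dimOf U x / β)]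
  · obtain ⟨k, p, n, h1, h2, h3, h4, h5⟩ := exists_blocks_eq_append hgrow N
    exact ⟨_, p, n, h1, h3, (hratio _ _).1 h4, hEs k p _ h2, by rw [← h5]; exact hpre (k + 1)⟩
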